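/- For every n ≥ 0, the number o_{0,1}^{(1,0)}(n) of osculating (0,1)-stars of length n with j_{n,2}−j_{n,1}=2 and j_{n,3}=j_{n,2} equals Σ_{k=1}^{n} (−1)^{n−k} b_k, where b_k is the k-th Baxter number b_k = (2/(k(k+1)^2)) · Σ_{r=0}^{k−1} C(k+1,r)·C(k+1,r+1)·C(k+1,r+2). -/

import Mathlib

/-- A single directed walk of length `n`: consecutive ordinates differ by `±1`. -/
def IsSteps {n : ℕ} (w : Fin (n + 1) → ℤ) : Prop :=
  ∀ m : Fin n, w m.succ - w m.castSucc = 1 ∨ w m.succ - w m.castSucc = -1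

/-- A configuration of three walkers is non-crossing if the ordinates stay ordered. -/
def NonCrossing {n : ℕ} (p : Fin 3 → Fin (n + 1) → ℤ) : Prop :=
  ∀ m, p 0 m ≤ p 1 m ∧ p 1 m ≤ p 2 m

/-- An osculating configuration of three walkers: three `±1`-step walks, non-crossing,
and whenever two neighbouring walkers meet at time `m < n` they separate at time `m+1`. -/
def Osculating {n : ℕ} (p : Fin 3 → Fin (n + 1) → ℤ) : Prop :=
  (∀ k, IsSteps (p k)) ∧ NonCrossing p ∧
    ∀ m : Fin n,
      (p 0 m.castSucc = p 1 m.castSucc → p 0 m.succ < p 1 m.succ) ∧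
      (p 1 m.castSucc = p 2 m.castSucc → p 1 m.succ < p 2 m.succ)

/-- A vicious (non-intersecting) configuration of three walkers. -/
def Vicious {n : ℕ} (p : Fin 3 → Fin (n + 1) → ℤ) : Prop :=
  (∀ k, IsSteps (p k)) ∧ ∀ m, p 0 m < p 1 m ∧ p 1 m < p 2 m

/-- An `(i,j)`-star starts at ordinates `0`, `2i`, `2(i+j)`. -/
def Starts {n : ℕ} (i j : ℕ) (p : Fin 3 → Fin (n + 1) → ℤ) : Prop :=
  p 0 0 = 0 ∧ p 1 0 = 2 * (i : ℤ) ∧ p 2 0 = 2 * ((i : ℤ) + (j : ℤ))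

/-- The `k`-th Baxter number `b_k = (2/(k(k+1)^2)) Σ_{r=0}^{k-1} C(k+1,r)C(k+1,r+1)C(k+1,r+2)`. -/
noncomputable def baxter (k : ℕ) : ℚ :=
  2 / ((k : ℚ) * ((k : ℚ) + 1) ^ 2) *
    ∑ r ∈ Finset.range k,
      ((k + 1).choose r * (k + 1).choose (r + 1) * (k + 1).choose (r + 2) : ℚ)

/-- The number of osculating `(0,1)`-stars of length `n` whose final gaps are `2 * a` and `2 * b`,
given by its transfer recurrence. -/
def oscCount : ℕ → ℤ → ℤ → ℤ
  | 0, a, b => if a = 0 ∧ b = 1 then 1 else 0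
  | n + 1, a, b => ∑ d : Bool × Bool × Bool,
      if 0 ≤ a ∧ 0 ≤ b ∧ (a + d.1.toInt - d.2.1.toInt = 0 → 0 < a) ∧
          (b + d.2.1.toInt - d.2.2.toInt = 0 → 0 < b)
        then oscCount n (a + d.1.toInt - d.2.1.toInt) (b + d.2.1.toInt - d.2.2.toInt) else 0

lemma oscCount_eq_zero_of_neg (n : ℕ) {a b : ℤ} (h : a < 0 ∨ b < 0) : oscCount n a b = 0 := by
  cases n with
  | zero => simp only [oscCount]; rw [if_neg]; omega
  | succ n =>
    simp only [oscCount]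
    refine Finset.sum_eq_zero fun d _ => if_neg ?_
    omega

lemma oscCount_zero_zero (n : ℕ) : oscCount n 0 0 = 0 := by
  cases n with
  | zero => simp [oscCount]
  | succ n =>
    simp only [oscCount]
    simp [Fintype.sum_prod_type, oscCount_eq_zero_of_neg]

lemma oscCount_succ_of_pos (n : ℕ) {a b : ℤ} (ha : 0 < a) (hb : 0 < b) :
    oscCount (n + 1) a b =
      2 * oscCount n a b + oscCount n (a + 1) b + oscCount n (a - 1) (b + 1) +
        oscCount n a (b - 1) + oscCount n a (b + 1) + oscCount n (a + 1) (b - 1) +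
        oscCount n (a - 1) b := by
  simp [oscCount, Fintype.sum_prod_type, ha, hb, ha.le, hb.le]
  ring

lemma oscCount_succ_zero_left (n : ℕ) {b : ℤ} (hb : 0 < b) :
    oscCount (n + 1) 0 b = oscCount n 1 b + oscCount n 1 (b - 1) := by
  simp [oscCount, Fintype.sum_prod_type, hb, hb.le, oscCount_eq_zero_of_neg]
  ring

lemma oscCount_succ_zero_right (n : ℕ) {a : ℤ} (ha : 0 < a) :
    oscCount (n + 1) a 0 = oscCount n a 1 + oscCount n (a - 1) 1 := by
  simp [oscCount, Fintype.sum_prod_type, ha, ha.le, oscCount_eq_zero_of_neg]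

/-- The combination of osculating counts which obeys the recurrence of vicious walkers. -/
def oscSum (n : ℕ) (a b : ℤ) : ℤ :=
  if 0 < a ∧ 0 < b then oscCount n a b + oscCount n (a - 1) b + oscCount n a (b - 1) else 0

lemma oscSum_of_pos (n : ℕ) {a b : ℤ} (ha : 0 < a) (hb : 0 < b) :
    oscSum n a b = oscCount n a b + oscCount n (a - 1) b + oscCount n a (b - 1) :=
  if_pos ⟨ha, hb⟩

lemma oscSum_zero_left (n : ℕ) (b : ℤ) : oscSum n 0 b = 0 := by simp [oscSum]

lemma oscSum_zero_right (n : ℕ) (a : ℤ) : oscSum n a 0 = 0 := by simp [oscSum]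

lemma oscSum_succ (n : ℕ) {a b : ℤ} (ha : 0 < a) (hb : 0 < b) :
    oscSum (n + 1) a b =
      2 * oscSum n a b + oscSum n (a + 1) b + oscSum n (a - 1) (b + 1) +
        oscSum n a (b - 1) + oscSum n a (b + 1) + oscSum n (a + 1) (b - 1) +
        oscSum n (a - 1) b := by
  have h00 := oscCount_zero_zero n
  rw [oscSum_of_pos _ ha hb, oscCount_succ_of_pos _ ha hb, oscSum_of_pos n ha hb,
    oscSum_of_pos n (show 0 < a + 1 by omega) hb, oscSum_of_pos n ha (show 0 < b + 1 by omega)]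
  rcases (show a = 1 ∨ 0 < a - 1 by omega) with rfl | ha' <;>
    rcases (show b = 1 ∨ 0 < b - 1 by omega) with rfl | hb'
  · norm_num [oscSum_zero_left, oscSum_zero_right, oscCount_succ_zero_left,
      oscCount_succ_zero_right, h00]
    ring
  · rw [oscCount_succ_of_pos _ ha hb', oscSum_of_pos n ha hb',
      oscSum_of_pos n (show (0 : ℤ) < 1 + 1 by omega) hb']
    norm_num [oscSum_zero_left, oscCount_succ_zero_left, hb]
    ring
  · rw [oscCount_succ_of_pos _ ha' hb, oscSum_of_pos n ha' hb,
      oscSum_of_pos n ha' (show (0 : ℤ) < 1 + 1 by omega)]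
    norm_num [oscSum_zero_right, oscCount_succ_zero_right, ha]
    ring
  · rw [oscCount_succ_of_pos _ ha' hb, oscCount_succ_of_pos _ ha hb', oscSum_of_pos n ha' hb,
      oscSum_of_pos n ha hb', oscSum_of_pos n ha' (show 0 < b + 1 by omega),
      oscSum_of_pos n (show 0 < a + 1 by omega) hb']
    simp only [sub_add_cancel, add_sub_cancel_right]
    ring

/-- Binomial coefficients with an integer lower index. -/
def intChoose (n : ℕ) (m : ℤ) : ℤ := if 0 ≤ m then (n.choose m.toNat : ℤ) else 0

lemma intChoose_natCast (n m : ℕ) : intChoose n m = n.choose m := by simp [intChoose]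

lemma intChoose_of_neg (n : ℕ) {m : ℤ} (h : m < 0) : intChoose n m = 0 :=
  if_neg (by omega)

lemma intChoose_of_lt (n : ℕ) {m : ℤ} (h : (n : ℤ) < m) : intChoose n m = 0 := by
  lift m to ℕ using by omega
  rw [intChoose_natCast, Nat.choose_eq_zero_of_lt (by omega), Nat.cast_zero]

lemma intChoose_succ (n : ℕ) (m : ℤ) :
    intChoose (n + 1) m = intChoose n m + intChoose n (m - 1) := by
  rcases lt_trichotomy m 0 with h | rfl | h
  · simp [intChoose_of_neg, h, show m - 1 < 0 by omega]
  · simp [intChoose]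
  · obtain ⟨k, rfl⟩ : ∃ k : ℕ, m = k + 1 := ⟨(m - 1).toNat, by omega⟩
    rw [add_sub_cancel_right, intChoose_natCast, ← Nat.cast_succ, intChoose_natCast,
      intChoose_natCast, Nat.choose_succ_succ]
    push_cast
    ring

/-- The determinant counting triples of non-intersecting paths from `0, 1, 2` to `i, j, k`. -/
def pathDet (n : ℕ) (i j k : ℤ) : ℤ :=
  intChoose n i * (intChoose n (j - 1) * intChoose n (k - 2) -
      intChoose n (j - 2) * intChoose n (k - 1)) -
    intChoose n (i - 1) * (intChoose n j * intChoose n (k - 2) -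
      intChoose n (j - 2) * intChoose n k) +
    intChoose n (i - 2) * (intChoose n j * intChoose n (k - 1) -
      intChoose n (j - 1) * intChoose n k)

lemma pathDet_self_left (n : ℕ) (i k : ℤ) : pathDet n i i k = 0 := by
  unfold pathDet; ring

lemma pathDet_self_right (n : ℕ) (i j : ℤ) : pathDet n i j j = 0 := by
  unfold pathDet; ring

lemma pathDet_of_neg (n : ℕ) {i : ℤ} (j k : ℤ) (h : i < 0) : pathDet n i j k = 0 := by
  simp [pathDet, intChoose_of_neg n h, intChoose_of_neg n (show i - 1 < 0 by omega),
    intChoose_of_neg n (show i - 2 < 0 by omega)]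

lemma pathDet_of_lt (n : ℕ) {i j k : ℤ} (hi : (n : ℤ) < i) (hj : (n : ℤ) < j)
    (hk : (n : ℤ) < k) : pathDet n i j k = 0 := by
  simp [pathDet, intChoose_of_lt n hi, intChoose_of_lt n hj, intChoose_of_lt n hk]

lemma pathDet_succ (n : ℕ) (i j k : ℤ) :
    pathDet (n + 1) i j k =
      pathDet n i j k + pathDet n i j (k - 1) + pathDet n i (j - 1) k +
        pathDet n i (j - 1) (k - 1) + pathDet n (i - 1) j k + pathDet n (i - 1) j (k - 1) +
        pathDet n (i - 1) (j - 1) k + pathDet n (i - 1) (j - 1) (k - 1) := by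
  simp only [pathDet, intChoose_succ, sub_sub]
  norm_num
  ring

/-- The number of vicious `(1,1)`-stars of length `n` with final gaps `2 * a` and `2 * b`. -/
def viciousCount (n : ℕ) (a b : ℤ) : ℤ :=
  ∑ r ∈ Finset.range (n + 1), pathDet n r (r + a) (r + a + b)

lemma sum_pathDet_range (n : ℕ) {a b : ℤ} (ha : 0 ≤ a) (hab : 0 ≤ a + b) :
    ∑ r ∈ Finset.range (n + 2), pathDet n r (r + a) (r + a + b) = viciousCount n a b := by
  rw [Finset.sum_range_succ, pathDet_of_lt, add_zero, viciousCount] <;> push_cast <;> omega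

lemma sum_pathDet_range_shift (n : ℕ) (a b : ℤ) :
    ∑ r ∈ Finset.range (n + 2), pathDet n (r - 1) (r - 1 + a) (r - 1 + a + b) =
      viciousCount n a b := by
  rw [Finset.sum_range_succ', pathDet_of_neg _ _ _ (by simp), add_zero, viciousCount]
  simp

lemma viciousCount_zero_left (n : ℕ) (b : ℤ) : viciousCount n 0 b = 0 := by
  simp [viciousCount, pathDet_self_left]

lemma viciousCount_zero_right (n : ℕ) (a : ℤ) : viciousCount n a 0 = 0 := by
  simp [viciousCount, pathDet_self_right]

lemma viciousCount_succ (n : ℕ) {a b : ℤ} (ha : 0 < a) (hb : 0 < b) :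
    viciousCount (n + 1) a b =
      2 * viciousCount n a b + viciousCount n (a + 1) b + viciousCount n (a - 1) (b + 1) +
        viciousCount n a (b - 1) + viciousCount n a (b + 1) + viciousCount n (a + 1) (b - 1) +
        viciousCount n (a - 1) b := by
  have h1 := sum_pathDet_range n (a := a) (b := b) (by omega) (by omega)
  have h2 := sum_pathDet_range n (a := a) (b := b - 1) (by omega) (by omega)
  have h3 := sum_pathDet_range n (a := a - 1) (b := b + 1) (by omega) (by omega)
  have h4 := sum_pathDet_range n (a := a - 1) (b := b) (by omega) (by omega)
  have h5 := sum_pathDet_range_shift n (a + 1) b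
  have h6 := sum_pathDet_range_shift n (a + 1) (b - 1)
  have h7 := sum_pathDet_range_shift n a (b + 1)
  have h8 := sum_pathDet_range_shift n a b
  have key : viciousCount (n + 1) a b =
      viciousCount n a b + viciousCount n a (b - 1) + viciousCount n (a - 1) (b + 1) +
      viciousCount n (a - 1) b + viciousCount n (a + 1) b + viciousCount n (a + 1) (b - 1) +
      viciousCount n a (b + 1) + viciousCount n a b := by
    nth_rw 1 [viciousCount]
    rw [← h2, ← h3, ← h4, ← h5, ← h6, ← h7]
    nth_rw 1 [← h1]
    rw [← h8]
    simp only [pathDet_succ, ← Finset.sum_add_distrib]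
    refine Finset.sum_congr rfl fun r _ => ?_
    congr! 2 <;> ring_nf
  rw [key]; ring

lemma oscSum_eq_viciousCount (n : ℕ) {a b : ℤ} (ha : 0 ≤ a) (hb : 0 ≤ b) :
    oscSum n a b = viciousCount n a b := by
  induction n generalizing a b with
  | zero =>
    have h (m : ℤ) : intChoose 0 m = if m = 0 then 1 else 0 := by
      rcases lt_trichotomy m 0 with h | rfl | h
      · rw [intChoose_of_neg 0 h, if_neg h.ne]
      · rfl
      · rw [intChoose_of_lt 0 (by simpa using h), if_neg h.ne']
    simp only [oscSum, oscCount, viciousCount, pathDet, h]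
    simp
    split_ifs <;> omega
  | succ n ih =>
    rcases ha.eq_or_lt with rfl | ha'
    · rw [oscSum_zero_left, viciousCount_zero_left]
    rcases hb.eq_or_lt with rfl | hb'
    · rw [oscSum_zero_right, viciousCount_zero_right]
    rw [oscSum_succ n ha' hb', viciousCount_succ n ha' hb']
    iterate 7 rw [ih (by omega) (by omega)]

/-- The reciprocal factorial, extended by zero to negative integers. -/
def invFactorial (m : ℤ) : ℚ := if 0 ≤ m then ((m.toNat.factorial : ℚ))⁻¹ else 0

lemma invFactorial_sub_one (m : ℤ) : invFactorial (m - 1) = m * invFactorial m := by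
  rcases lt_trichotomy m 0 with h | rfl | h
  · simp [invFactorial, show ¬ 0 ≤ m by omega, show ¬ 1 ≤ m by omega]
  · simp [invFactorial]
  · obtain ⟨k, rfl⟩ : ∃ k : ℕ, m = k + 1 := ⟨(m - 1).toNat, by omega⟩
    have : ((k : ℤ) + 1).toNat = k + 1 := by omega
    have h0 : (k : ℚ) + 1 ≠ 0 := by positivity
    have h1 : (k.factorial : ℚ) ≠ 0 := by positivity
    simp [invFactorial, this, show (0 : ℤ) ≤ k + 1 by omega, Nat.factorial_succ]
    field_simp

lemma intChoose_eq_factorial (n : ℕ) (m : ℤ) :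
    (intChoose n m : ℚ) = n.factorial * (invFactorial m * invFactorial (n - m)) := by
  rcases lt_or_ge m 0 with h | h
  · simp [intChoose_of_neg n h, invFactorial, not_le.2 h]
  rcases lt_or_ge (n : ℤ) m with h' | h'
  · simp [intChoose_of_lt n h', invFactorial, not_le.2 h']
  lift m to ℕ using h
  have hm : m ≤ n := by omega
  rw [intChoose_natCast, Int.cast_natCast, Nat.cast_choose ℚ hm]
  simp [invFactorial, hm, show ((n : ℤ) - m).toNat = n - m by omega]
  field_simp

lemma pathDet_consecutive (n r : ℕ) :
    (pathDet n r (r + 1) (r + 1 + 1) : ℚ) =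
      2 / (((n + 1 : ℕ) : ℚ) * (((n + 1 : ℕ) : ℚ) + 1) ^ 2) *
        ((n + 1 + 1).choose r * (n + 1 + 1).choose (r + 1) * (n + 1 + 1).choose (r + 2)) := by
  have e (k : ℕ) : ((n + 2).choose k : ℚ) = (intChoose (n + 2) k : ℚ) := by
    rw [intChoose_natCast, Int.cast_natCast]
  have g1 := invFactorial_sub_one (r + 2)
  have g2 := invFactorial_sub_one (r + 1)
  have g3 := invFactorial_sub_one r
  have g4 := invFactorial_sub_one (r - 1)
  have k1 := invFactorial_sub_one (n - r + 2)
  have k2 := invFactorial_sub_one (n - r + 1)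
  have k3 := invFactorial_sub_one (n - r)
  have k4 := invFactorial_sub_one (n - r - 1)
  have hf : ((n + 2).factorial : ℚ) = (n + 2) * ((n + 1) * n.factorial) := by
    rw [Nat.factorial_succ, Nat.factorial_succ]; push_cast; ring
  have h1 : (n : ℚ) + 1 ≠ 0 := by positivity
  have h2 : (n : ℚ) + 1 + 1 ≠ 0 := by positivity
  rw [show n + 1 + 1 = n + 2 from rfl, e, e, e]
  unfold pathDet
  push_cast
  simp only [intChoose_eq_factorial, hf]
  push_cast
  rw [show (r : ℤ) + 2 - 1 = r + 1 by ring] at g1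
  rw [show (r : ℤ) + 1 - 1 = r by ring] at g2
  rw [show (r : ℤ) - 1 - 1 = r - 2 by ring] at g4
  rw [show (n : ℤ) - r + 2 - 1 = n - r + 1 by ring] at k1
  rw [show (n : ℤ) - r + 1 - 1 = n - r by ring] at k2
  rw [show (n : ℤ) - r - 1 - 1 = n - r - 2 by ring] at k4
  push_cast at g1 g2 g3 g4 k1 k2 k3 k4
  rw [show (r : ℤ) + 1 - 1 = r by ring, show (r : ℤ) + 1 + 1 - 1 = r + 1 by ring,
    show (r : ℤ) + 1 + 1 - 2 = r by ring, show (r : ℤ) + 1 - 2 = r - 1 by ring,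
    show (r : ℤ) + 1 + 1 = r + 2 by ring, show (n : ℤ) - (r - 2) = n - r + 2 by ring,
    show (n : ℤ) - (r - 1) = n - r + 1 by ring, show (n : ℤ) - (r + 1) = n - r - 1 by ring,
    show (n : ℤ) - (r + 2) = n - r - 2 by ring, show (n : ℤ) + 2 - r = n - r + 2 by ring,
    show (n : ℤ) + 2 - (r + 1) = n - r + 1 by ring, show (n : ℤ) + 2 - (r + 2) = n - r by ring,
    g4, g3, g2, g1, k4, k3, k2, k1]
  field_simp
  ring

lemma viciousCount_one_one (n : ℕ) : (viciousCount n 1 1 : ℚ) = baxter (n + 1) := by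
  rw [viciousCount, baxter, Finset.mul_sum]
  push_cast
  refine Finset.sum_congr rfl fun r _ => ?_
  simpa using pathDet_consecutive n r

lemma oscCount_one_zero_succ (n : ℕ) :
    (oscCount (n + 1) 1 0 : ℚ) = baxter (n + 1) - oscCount n 1 0 := by
  rw [← viciousCount_one_one, ← oscSum_eq_viciousCount n (by norm_num) (by norm_num),
    oscSum_of_pos n (by norm_num) (by norm_num), oscCount_succ_zero_right n (by norm_num)]
  push_cast
  norm_num

lemma oscCount_one_zero_eq_sum (n : ℕ) :
    (oscCount n 1 0 : ℚ) = ∑ k ∈ Finset.Icc 1 n, (-1 : ℚ) ^ (n - k) * baxter k := by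
  induction n with
  | zero => simp [oscCount]
  | succ n ih =>
    rw [oscCount_one_zero_succ, ih, Finset.sum_Icc_succ_top (by omega), Nat.sub_self, pow_zero,
      one_mul, sub_eq_neg_add, ← Finset.sum_neg_distrib]
    congr 1
    refine Finset.sum_congr rfl fun k hk => ?_
    rw [Nat.succ_sub (Finset.mem_Icc.1 hk).2, pow_succ]
    ring

/-- The osculating `(0,1)`-stars of length `n` with final gaps `2 * a` and `2 * b`. -/
def IsOscStar (n : ℕ) (a b : ℤ) (p : Fin 3 → Fin (n + 1) → ℤ) : Prop :=
  Osculating p ∧ Starts 0 1 p ∧ p 1 (Fin.last n) - p 0 (Fin.last n) = 2 * a ∧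
    p 2 (Fin.last n) - p 1 (Fin.last n) = 2 * b

/-- The step of `±1` encoded by a Boolean. -/
def boolStep (d : Bool) : ℤ := 2 * d.toInt - 1

/-- The steps of the three walkers encoded by a triple of Booleans. -/
def tripleStep (d : Bool × Bool × Bool) : Fin 3 → ℤ :=
  ![boolStep d.1, boolStep d.2.1, boolStep d.2.2]

/-- Extend a configuration by one more step of each walker. -/
def extendConfig {n : ℕ} (p : Fin 3 → Fin (n + 1) → ℤ) (d : Bool × Bool × Bool) :
    Fin 3 → Fin (n + 2) → ℤ :=
  fun k => Fin.snoc (α := fun _ => ℤ) (p k) (p k (Fin.last n) + tripleStep d k)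

/-- The configuration with its last step removed. -/
def initConfig {n : ℕ} (p : Fin 3 → Fin (n + 2) → ℤ) : Fin 3 → Fin (n + 1) → ℤ :=
  fun k m => p k m.castSucc

/-- The last steps of the three walkers. -/
def lastStep {n : ℕ} (p : Fin 3 → Fin (n + 2) → ℤ) : Bool × Bool × Bool :=
  let f k := decide (p k (Fin.last n).castSucc < p k (Fin.last (n + 1)))
  (f 0, f 1, f 2)

lemma extendConfig_castSucc {n : ℕ} (p : Fin 3 → Fin (n + 1) → ℤ) (d : Bool × Bool × Bool)
    (k : Fin 3) (m : Fin (n + 1)) : extendConfig p d k m.castSucc = p k m := by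
  simp [extendConfig]

lemma extendConfig_last {n : ℕ} (p : Fin 3 → Fin (n + 1) → ℤ) (d : Bool × Bool × Bool)
    (k : Fin 3) : extendConfig p d k (Fin.last (n + 1)) = p k (Fin.last n) + tripleStep d k := by
  simp [extendConfig]

lemma initConfig_extendConfig {n : ℕ} (p : Fin 3 → Fin (n + 1) → ℤ) (d : Bool × Bool × Bool) :
    initConfig (extendConfig p d) = p := by
  funext k m
  simp [initConfig, extendConfig_castSucc]

lemma decide_boolStep_pos (d : Bool) : decide (0 < boolStep d) = d := by
  cases d <;> rfl

lemma lastStep_extendConfig {n : ℕ} (p : Fin 3 → Fin (n + 1) → ℤ) (d : Bool × Bool × Bool) :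
    lastStep (extendConfig p d) = d := by
  simp [lastStep, extendConfig_castSucc, extendConfig_last, tripleStep, decide_boolStep_pos]

lemma boolStep_decide {x y : ℤ} (h : y - x = 1 ∨ y - x = -1) :
    x + boolStep (decide (x < y)) = y := by
  rcases h with h | h
  · rw [decide_eq_true (by omega)]; simp [boolStep]; omega
  · rw [decide_eq_false (by omega)]; simp [boolStep]; omega

lemma extendConfig_initConfig {n : ℕ} {p : Fin 3 → Fin (n + 2) → ℤ} (h : ∀ k, IsSteps (p k)) :
    extendConfig (initConfig p) (lastStep p) = p := by
  funext k m
  induction m using Fin.lastCases with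
  | cast m => rw [extendConfig_castSucc, initConfig]
  | last =>
    rw [extendConfig_last, initConfig]
    have hk := boolStep_decide (h k (Fin.last n))
    fin_cases k <;> exact hk

/-- The condition under which a step triple may lead to the gaps `2 * a` and `2 * b`. -/
abbrev StepAllowed (a b : ℤ) (d : Bool × Bool × Bool) : Prop :=
  0 ≤ a ∧ 0 ≤ b ∧ (a + d.1.toInt - d.2.1.toInt = 0 → 0 < a) ∧
    (b + d.2.1.toInt - d.2.2.toInt = 0 → 0 < b)

lemma isOscStar_extendConfig {n : ℕ} (a b : ℤ) (p : Fin 3 → Fin (n + 1) → ℤ)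
    (d : Bool × Bool × Bool) :
    IsOscStar (n + 1) a b (extendConfig p d) ↔
      StepAllowed a b d ∧
        IsOscStar n (a + d.1.toInt - d.2.1.toInt) (b + d.2.1.toInt - d.2.2.toInt) p := by
  have hs (k : Fin 3) : tripleStep d k = 1 ∨ tripleStep d k = -1 := by
    obtain ⟨d0, d1, d2⟩ := d
    fin_cases k <;> cases d0 <;> cases d1 <;> cases d2 <;> decide
  have h0 (k : Fin 3) : extendConfig p d k 0 = p k 0 := extendConfig_castSucc p d k 0
  have t0 : tripleStep d 0 = 2 * d.1.toInt - 1 := rfl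
  have t1 : tripleStep d 1 = 2 * d.2.1.toInt - 1 := rfl
  have t2 : tripleStep d 2 = 2 * d.2.2.toInt - 1 := rfl
  simp only [IsOscStar, StepAllowed, Osculating, IsSteps, NonCrossing, Starts,
    Fin.forall_fin_succ' (n := n), Fin.forall_fin_succ' (n := n + 1), h0, extendConfig_castSucc,
    extendConfig_last, Fin.succ_castSucc, Fin.succ_last, add_sub_cancel_left, hs, and_true, t0, t1,
    t2]
  constructor
  · rintro ⟨⟨hk, ⟨hn, hn'⟩, ho, ho'⟩, hst, ha, hb⟩
    exact ⟨by omega, ⟨hk, hn, ho⟩, hst, by omega, by omega⟩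
  · rintro ⟨hal, ⟨hk, hn, ho⟩, hst, ha, hb⟩
    exact ⟨⟨hk, ⟨hn, by omega⟩, ho, by omega⟩, hst, by omega, by omega⟩

/-- Splitting off the last step of a star. -/
def oscStarSuccEquiv (n : ℕ) (a b : ℤ) :
    {p // IsOscStar (n + 1) a b p} ≃ (d : Bool × Bool × Bool) ×
      {p : Fin 3 → Fin (n + 1) → ℤ // StepAllowed a b d ∧
        IsOscStar n (a + d.1.toInt - d.2.1.toInt) (b + d.2.1.toInt - d.2.2.toInt) p} where
  toFun p := ⟨lastStep p.1, initConfig p.1, by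
    rw [← isOscStar_extendConfig, extendConfig_initConfig p.2.1.1]; exact p.2⟩
  invFun q := ⟨extendConfig q.2.1 q.1, (isOscStar_extendConfig a b _ _).2 q.2.2⟩
  left_inv p := Subtype.ext (extendConfig_initConfig p.2.1.1)
  right_inv q := by
    obtain ⟨d, p, hp⟩ := q
    refine Sigma.subtype_ext ?_ ?_
    · exact lastStep_extendConfig p d
    · exact initConfig_extendConfig p d

lemma isOscStar_zero (a b : ℤ) (p : Fin 3 → Fin 1 → ℤ) :
    IsOscStar 0 a b p ↔ (a = 0 ∧ b = 1) ∧ p = ![fun _ => 0, fun _ => 0, fun _ => 2] := by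
  simp [IsOscStar, Osculating, IsSteps, NonCrossing, Starts, funext_iff, Fin.forall_fin_succ]
  omega

lemma finite_and_card_isOscStar (n : ℕ) (a b : ℤ) :
    Finite {p // IsOscStar n a b p} ∧
      (Nat.card {p // IsOscStar n a b p} : ℤ) = oscCount n a b := by
  induction n generalizing a b with
  | zero =>
    simp only [isOscStar_zero, oscCount]
    by_cases h : a = 0 ∧ b = 1
    · simp only [h, true_and, and_self, if_true]
      exact ⟨inferInstance, by simp⟩
    · simp only [h, false_and, if_false]
      exact ⟨inferInstance, by simp⟩
  | succ n ih =>
    have (d : Bool × Bool × Bool) : Finite {p : Fin 3 → Fin (n + 1) → ℤ // StepAllowed a b d ∧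
        IsOscStar n (a + d.1.toInt - d.2.1.toInt) (b + d.2.1.toInt - d.2.2.toInt) p} :=
      have := (ih (a + d.1.toInt - d.2.1.toInt) (b + d.2.1.toInt - d.2.2.toInt)).1
      Finite.of_injective _ (Subtype.impEmbedding _ _ fun _ h => h.2).injective
    refine ⟨Finite.of_equiv _ (oscStarSuccEquiv n a b).symm, ?_⟩
    rw [Nat.card_congr (oscStarSuccEquiv n a b), Nat.card_sigma, oscCount]
    push_cast
    refine Finset.sum_congr rfl fun d _ => ?_
    rw [← (ih _ _).2]
    change _ = ite (StepAllowed a b d) _ _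
    split_ifs with h
    · simp only [and_iff_right h]
    · simp only [h, false_and, Nat.card_of_isEmpty, Nat.cast_zero]

theorem osculating_zero_one_alternating_baxter (n : ℕ) :
    (Nat.card {p : Fin 3 → Fin (n + 1) → ℤ // Osculating p ∧ Starts 0 1 p ∧
        p 1 (Fin.last n) - p 0 (Fin.last n) = 2 ∧
        p 2 (Fin.last n) = p 1 (Fin.last n)} : ℚ) =
      ∑ k ∈ Finset.Icc 1 n, (-1 : ℚ) ^ (n - k) * baxter k := by
  rw [← oscCount_one_zero_eq_sum, ← (finite_and_card_isOscStar n 1 0).2, Int.cast_natCast]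
  simp only [IsOscStar, mul_one, mul_zero, sub_eq_zero]
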